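/- arXiv:2507.10351 — 2 statements merged into one kernel-verified Lean document; each statement's English description precedes it below -/
import Mathlib

section
/- Let Δ and h be integers at least 3, let T_{Δ,h} be the tree with vertices of degrees 1 and Δ only in which every leaf has distance exactly h from some fixed root vertex of degree Δ, and let s_{Δ,h} be the degree sequence of T_{Δ,h}. Then rad(s_{Δ,h}) = h, i.e., every tree with the same degree sequence as T_{Δ,h} has radius at least h, and T_{Δ,h} itself has radius h. -/
open SimpleGraph

/-- The degree of a vertex `v` in a graph `G`. -/
noncomputable def gdeg {V : Type*} (G : SimpleGraph V) (v : V) : ℕ := {u | G.Adj v u}.ncard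

/-- A leaf of a tree: a vertex of degree at most `1`. -/
def IsLeafV {V : Type*} (G : SimpleGraph V) (v : V) : Prop := gdeg G v ≤ 1

/-- The set of lengths of leaf-to-leaf paths in a tree (in a tree the unique path
between two vertices has length equal to their distance); the trivial one-vertex
paths of length `0` are included. -/
def lpSet {V : Type*} (G : SimpleGraph V) : Set ℕ :=
  {n | ∃ u v : V, IsLeafV G u ∧ IsLeafV G v ∧ G.dist u v = n}

/-- In the tree `G` rooted at `r`, `u` is a child of `v`. -/
def IsChild {V : Type*} (G : SimpleGraph V) (r v u : V) : Prop :=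
  G.Adj v u ∧ G.dist r u = G.dist r v + 1

/-- The out-degree (number of children) of `v` in the tree `G` rooted at `r`. -/
noncomputable def outdeg {V : Type*} (G : SimpleGraph V) (r v : V) : ℕ :=
  {u | IsChild G r v u}.ncard

/-- A leaf of the rooted tree `(G, r)`: a vertex without children. -/
def IsRLeaf {V : Type*} (G : SimpleGraph V) (r v : V) : Prop := ∀ u, ¬ IsChild G r v u

/-- The height of the rooted tree `(G, r)`: the maximum depth of a vertex. -/
noncomputable def rheight {V : Type*} (G : SimpleGraph V) (r : V) : ℕ :=
  sSup {d | ∃ v, G.dist r v = d}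

/-- The out-degree sequence (as a multiset) of the rooted tree `(G, r)`. -/
noncomputable def outDegSeq {V : Type*} [Fintype V] (G : SimpleGraph V) (r : V) : Multiset ℕ :=
  Multiset.map (outdeg G r) Finset.univ.val

/-- The degree sequence (as a multiset) of `G`. -/
noncomputable def degSeq {V : Type*} [Fintype V] (G : SimpleGraph V) : Multiset ℕ :=
  Multiset.map (gdeg G) Finset.univ.val

/-- The eccentricity of a vertex. -/
noncomputable def ecc {V : Type*} (G : SimpleGraph V) (v : V) : ℕ := sSup {d | ∃ u, G.dist v u = d}

/-- The radius of `G`. -/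
noncomputable def treeRadius {V : Type*} (G : SimpleGraph V) : ℕ := sInf {e | ∃ v, ecc G v = e}

/-- The diameter of `G`. -/
noncomputable def treeDiam {V : Type*} (G : SimpleGraph V) : ℕ := sSup {d | ∃ u v : V, G.dist u v = d}

/-- `radSeq s` is the minimum radius of a tree with degree sequence `s`. -/
noncomputable def radSeq (s : Multiset ℕ) : ℕ :=
  sInf {e | ∃ G : SimpleGraph (Fin (Multiset.card s)), G.IsTree ∧ degSeq G = s ∧ treeRadius G = e}

/-- `hSeq s` is the minimum height of a rooted tree with out-degree sequence `s`. -/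
noncomputable def hSeq (s : Multiset ℕ) : ℕ :=
  sInf {h | ∃ (G : SimpleGraph (Fin (Multiset.card s))) (r : Fin (Multiset.card s)),
    G.IsTree ∧ outDegSeq G r = s ∧ rheight G r = h}

/-- The feasible heights for `hSeqK s k`: heights of rooted trees with at least `k` leaves
whose out-degree sequence is a subsequence of `s`. -/
def hFeas (s : Multiset ℕ) (k : ℕ) : Set ℕ :=
  {h | ∃ (m : ℕ) (G : SimpleGraph (Fin m)) (r : Fin m),
    G.IsTree ∧ outDegSeq G r ≤ s ∧ k ≤ {v | IsRLeaf G r v}.ncard ∧ rheight G r = h}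

/-- `hSeqK s k` is the minimum height of a rooted tree with at least `k` leaves whose
out-degree sequence is a subsequence of `s`. -/
noncomputable def hSeqK (s : Multiset ℕ) (k : ℕ) : ℕ := sInf (hFeas s k)

/-- In the tree `G` rooted at `r`, `a` is an ancestor of `b` (i.e. `a` lies on the path
from `r` to `b`). -/
def Ancestor {V : Type*} (G : SimpleGraph V) (r a b : V) : Prop :=
  G.dist r a + G.dist a b = G.dist r b

open Classical in
/-- The out-degree sequence of the rooted subtree of `(G, r)` at `w` (its vertices are the
descendants of `w`, and their children in the subtree coincide with their children in `(G, r)`). -/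
noncomputable def subSeq {V : Type*} [Fintype V] (G : SimpleGraph V) (r w : V) : Multiset ℕ :=
  Multiset.map (outdeg G r) (Multiset.filter (fun x => Ancestor G r w x) Finset.univ.val)

theorem parent_unique {V : Type*} {G : SimpleGraph V} (hT : G.IsTree) {r v a b : V}
    (ha : G.Adj v a) (hb : G.Adj v b) (hda : G.dist r v = G.dist r a + 1)
    (hdb : G.dist r v = G.dist r b + 1) : a = b := by
  obtain ⟨p, hp⟩ := hT.connected.exists_walk_length_eq_dist a r
  obtain ⟨q, hq⟩ := hT.connected.exists_walk_length_eq_dist b r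
  have e1 : G.dist v r = G.dist a r + 1 := by
    rw [G.dist_comm (u := v), G.dist_comm (u := a)]; exact hda
  have e2 : G.dist v r = G.dist b r + 1 := by
    rw [G.dist_comm (u := v), G.dist_comm (u := b)]; exact hdb
  have h1 : (Walk.cons ha p).IsPath :=
    Walk.isPath_of_length_eq_dist _ (by rw [Walk.length_cons, hp, e1])
  have h2 : (Walk.cons hb q).IsPath :=
    Walk.isPath_of_length_eq_dist _ (by rw [Walk.length_cons, hq, e2])
  have h3 := (hT.existsUnique_path v r).unique h1 h2
  have h4 := congrArg Walk.snd h3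
  simpa using h4

theorem parent_exists {V : Type*} {G : SimpleGraph V} (hT : G.IsTree) {r v : V}
    (hv : 0 < G.dist r v) : ∃ a, G.Adj v a ∧ G.dist r v = G.dist r a + 1 := by
  obtain ⟨p, hp⟩ := hT.connected.exists_walk_length_eq_dist v r
  rw [G.dist_comm (u := v)] at hp
  cases p with
  | nil => simp at hv
  | cons h q =>
    rename_i a
    refine ⟨a, h, ?_⟩
    rw [Walk.length_cons] at hp
    have h1 := G.dist_le q
    rw [G.dist_comm (u := a)] at h1
    have := hT.dist_eq_dist_add_one_of_adj r h
    omega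

/-- The layer at distance `i` from `r`. -/
noncomputable def layer {V : Type*} [Fintype V] (G : SimpleGraph V) (r : V) (i : ℕ) : Finset V :=
  haveI := Classical.decPred fun v => G.dist r v = i
  Finset.univ.filter fun v => G.dist r v = i

theorem mem_layer {V : Type*} [Fintype V] (G : SimpleGraph V) (r : V) (i : ℕ) (v : V) :
    v ∈ layer G r i ↔ G.dist r v = i := by
  simp [layer]

theorem card_layer_succ {V : Type*} [Fintype V] {G : SimpleGraph V} (hT : G.IsTree) (r : V)
    (i : ℕ) : (layer G r (i + 1)).card = ∑ v ∈ layer G r i, outdeg G r v := by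
  classical
  have : layer G r (i + 1) =
      (layer G r i).biUnion (fun v => Finset.univ.filter fun u => IsChild G r v u) := by
    ext u
    simp only [mem_layer, Finset.mem_biUnion, Finset.mem_filter, Finset.mem_univ,
      true_and]
    constructor
    · intro hu
      obtain ⟨a, ha, hd⟩ := parent_exists hT (r := r) (v := u) (by omega)
      exact ⟨a, by omega, ha.symm, hd⟩
    · rintro ⟨a, ha, _, hd⟩
      omega
  rw [this, Finset.card_biUnion]
  · refine Finset.sum_congr rfl fun v _ => ?_
    rw [outdeg, ← Set.ncard_coe_finset]
    congr 1
    ext u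
    simp
  · intro a _ b _ hab
    refine Finset.disjoint_left.2 ?_
    intro u hu hu'
    simp only [Finset.mem_filter, Finset.mem_univ,
      true_and] at hu hu'
    exact hab (parent_unique hT hu.1.symm hu'.1.symm hu.2 hu'.2)

theorem outdeg_root {V : Type*} {G : SimpleGraph V} (hT : G.IsTree) (r : V) :
    outdeg G r r = gdeg G r := by
  unfold outdeg gdeg IsChild
  congr 1
  ext u
  simp only [Set.mem_ofPred_eq, dist_self, zero_add]
  exact ⟨fun h => h.1, fun h => ⟨h, dist_eq_one_iff_adj.2 h⟩⟩

theorem outdeg_add_one {V : Type*} [Fintype V] {G : SimpleGraph V} (hT : G.IsTree) {r v : V}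
    (hv : 0 < G.dist r v) : outdeg G r v + 1 = gdeg G v := by
  obtain ⟨a, ha, hd⟩ := parent_exists hT hv
  have : {u | G.Adj v u} = insert a {u | IsChild G r v u} := by
    ext u
    simp only [Set.mem_ofPred_eq, IsChild, Set.mem_insert_iff]
    constructor
    · intro hu
      rcases hT.dist_eq_dist_add_one_of_adj r hu with h | h
      · exact Or.inl (parent_unique hT hu ha h hd)
      · exact Or.inr ⟨hu, h⟩
    · rintro (rfl | h)
      · exact ha
      · exact h.1
  rw [gdeg, this, Set.ncard_insert_of_notMem, outdeg]
  · simp only [IsChild, Set.mem_ofPred_eq]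
    omega

/-- The size of layer `i` in the full tree. -/
def fsize (Δ : ℕ) : ℕ → ℕ
  | 0 => 1
  | 1 => Δ
  | (i + 2) => fsize Δ (i + 1) * (Δ - 1)

theorem layer_zero {V : Type*} [Fintype V] {G : SimpleGraph V} (hT : G.IsTree) (r : V) :
    layer G r 0 = {r} := by
  ext v
  rw [mem_layer, hT.connected.dist_eq_zero_iff, Finset.mem_singleton, eq_comm]

theorem card_layer_le {V : Type*} [Fintype V] {G : SimpleGraph V} (hT : G.IsTree) (r : V)
    (Δ : ℕ) (hd : ∀ v, gdeg G v ≤ Δ) (i : ℕ) : (layer G r i).card ≤ fsize Δ i := by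
  induction i using fsize.induct with
  | case1 => simp [layer_zero hT, fsize]
  | case2 => simp [card_layer_succ hT r 0, layer_zero hT, fsize, outdeg_root hT, hd]
  | case3 i ih =>
    rw [card_layer_succ hT, fsize]
    refine (Finset.sum_le_card_nsmul _ _ (Δ - 1) fun v hv => ?_).trans ?_
    · rw [mem_layer] at hv
      have := outdeg_add_one hT (r := r) (v := v) (by omega)
      have := hd v
      omega
    · rw [smul_eq_mul]
      gcongr

theorem card_layer_eq {V : Type*} [Fintype V] {G : SimpleGraph V} (hT : G.IsTree) (r : V)
    (Δ h : ℕ) (hd : ∀ v, G.dist r v < h → gdeg G v = Δ) (i : ℕ) (hi : i ≤ h) :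
    (layer G r i).card = fsize Δ i := by
  induction i using fsize.induct with
  | case1 => simp [layer_zero hT, fsize]
  | case2 =>
    have := hd r (by simp; omega)
    simp [card_layer_succ hT r 0, layer_zero hT, fsize, outdeg_root hT, this]
  | case3 i ih =>
    rw [card_layer_succ hT, fsize, ← ih (by omega)]
    refine Finset.sum_const_nat fun v hv => ?_
    rw [mem_layer] at hv
    have := outdeg_add_one hT (r := r) (v := v) (by omega)
    have := hd v (by omega)
    omega

theorem fsize_pos (Δ : ℕ) (hΔ : 3 ≤ Δ) (i : ℕ) : 0 < fsize Δ i := by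
  induction i using fsize.induct with
  | case1 => simp [fsize]
  | case2 => simp [fsize]; omega
  | case3 i ih => rw [fsize]; exact Nat.mul_pos ih (by omega)

theorem bdd_ecc {V : Type*} [Fintype V] (G : SimpleGraph V) (v : V) :
    BddAbove {d | ∃ u, G.dist v u = d} :=
  (Set.finite_range (fun u => G.dist v u)).bddAbove

theorem dist_le_ecc {V : Type*} [Fintype V] (G : SimpleGraph V) (v u : V) :
    G.dist v u ≤ ecc G v := le_csSup (bdd_ecc G v) ⟨u, rfl⟩

theorem ecc_le {V : Type*} (G : SimpleGraph V) (v : V) (k : ℕ)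
    (h : ∀ u, G.dist v u ≤ k) : ecc G v ≤ k := by
  refine csSup_le ⟨_, v, rfl⟩ ?_
  rintro _ ⟨u, rfl⟩
  exact h u

theorem card_le_layers {V : Type*} [Fintype V] (G : SimpleGraph V) (v : V) (k : ℕ)
    (h : ∀ u, G.dist v u < k) :
    Fintype.card V = ∑ i ∈ Finset.range k, (layer G v i).card := by
  classical
  rw [← Finset.card_univ, Finset.card_eq_sum_card_fiberwise (f := fun u => G.dist v u)
    (t := Finset.range k)]
  · refine Finset.sum_congr rfl fun i _ => ?_
    congr 1
    ext u
    simp [mem_layer]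
  · intro u _
    simpa using h u

theorem layers_le_card {V : Type*} [Fintype V] (G : SimpleGraph V) (v : V) (k : ℕ) :
    ∑ i ∈ Finset.range k, (layer G v i).card ≤ Fintype.card V := by
  classical
  rw [← Finset.card_biUnion]
  · exact Finset.card_le_univ _
  · intro a _ b _ hab
    refine Finset.disjoint_left.2 ?_
    intro u hu hu'
    rw [mem_layer] at hu hu'
    omega

theorem le_ecc {V : Type*} [Fintype V] (G : SimpleGraph V) (hT : G.IsTree) (Δ h : ℕ)
    (hd : ∀ v, gdeg G v ≤ Δ) (hc : ∑ i ∈ Finset.range h, fsize Δ i < Fintype.card V) (v : V) :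
    h ≤ ecc G v := by
  by_contra hlt
  push Not at hlt
  have := card_le_layers G v h fun u => (dist_le_ecc G v u).trans_lt hlt
  have h2 : ∑ i ∈ Finset.range h, (layer G v i).card ≤ ∑ i ∈ Finset.range h, fsize Δ i :=
    Finset.sum_le_sum fun i _ => card_layer_le hT v Δ hd i
  omega

theorem le_radius {V : Type*} [Fintype V] (G : SimpleGraph V) (hT : G.IsTree) (Δ h : ℕ)
    (hd : ∀ v, gdeg G v ≤ Δ) (hc : ∑ i ∈ Finset.range h, fsize Δ i < Fintype.card V) :
    h ≤ treeRadius G := by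
  have := hT.connected.nonempty
  refine le_csInf ⟨_, Classical.arbitrary V, rfl⟩ ?_
  rintro _ ⟨v, rfl⟩
  exact le_ecc G hT Δ h hd hc v

theorem iso_dist_le {V W : Type*} {G : SimpleGraph V} {H : SimpleGraph W} (hT : G.Connected)
    (e : G ≃g H) (a b : V) : H.dist (e a) (e b) ≤ G.dist a b := by
  obtain ⟨p, hp⟩ := hT.exists_walk_length_eq_dist a b
  rw [← hp, ← Walk.length_map e.toHom p]
  exact dist_le _

theorem iso_gdeg {V W : Type*} {G : SimpleGraph V} {H : SimpleGraph W}
    (e : G ≃g H) (a : V) : gdeg H (e a) = gdeg G a := by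
  unfold gdeg
  rw [← Set.ncard_image_of_injective _ e.injective]
  congr 1
  ext w
  obtain ⟨b, rfl⟩ := e.surjective w
  simp only [Set.mem_ofPred_eq, Set.mem_image, EmbeddingLike.apply_eq_iff_eq, exists_eq_right]
  exact e.map_adj_iff

theorem iso_degSeq {V W : Type*} [Fintype V] [Fintype W] {G : SimpleGraph V} {H : SimpleGraph W}
    (f : G ≃g H) : degSeq H = degSeq G := by
  have : gdeg G = gdeg H ∘ f := funext fun v => (iso_gdeg f v).symm
  unfold degSeq
  rw [this, ← Multiset.map_map]
  congr 1
  have h1 : (Finset.univ.map f.toEquiv.toEmbedding) = Finset.univ :=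
    Finset.map_univ_equiv f.toEquiv
  rw [← h1]
  rfl

theorem radius_le {V : Type*} (G : SimpleGraph V) (v : V) : treeRadius G ≤ ecc G v :=
  Nat.sInf_le (show ecc G v ∈ {e | ∃ v, ecc G v = e} from ⟨v, rfl⟩)

theorem stmt_14 {V : Type*} [Fintype V] (G : SimpleGraph V) (hT : G.IsTree)
    (Δ h : ℕ) (hΔ : 3 ≤ Δ) (hh : 3 ≤ h) (r : V)
    (hdeg : ∀ v : V, gdeg G v = 1 ∨ gdeg G v = Δ) (hr : gdeg G r = Δ)
    (hleaf : ∀ v : V, IsLeafV G v → G.dist r v = h) :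
    treeRadius G = h ∧ radSeq (degSeq G) = h := by
  classical
  have hdle : ∀ v, gdeg G v ≤ Δ := fun v => by rcases hdeg v with h | h <;> omega
  have hdlt : ∀ v, G.dist r v < h → gdeg G v = Δ := by
    intro v hv
    rcases hdeg v with h1 | h1
    · have := hleaf v h1.le
      omega
    · exact h1
  have hc : ∑ i ∈ Finset.range h, fsize Δ i < Fintype.card V := by
    have h1 := layers_le_card G r (h + 1)
    rw [Finset.sum_congr rfl fun i hi =>
      card_layer_eq hT r Δ h hdlt i (by simp at hi; omega), Finset.sum_range_succ] at h1
    have := fsize_pos Δ hΔ h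
    omega
  have hdist : ∀ v, G.dist r v ≤ h := by
    obtain ⟨m, -, hm⟩ := Finset.exists_max_image Finset.univ (fun v => G.dist r v) ⟨r, by simp⟩
    suffices G.dist r m ≤ h from fun v => (hm v (by simp)).trans this
    by_contra hlt
    push Not at hlt
    rcases hdeg m with h1 | h1
    · have := hleaf m h1.le
      omega
    · have h2 := outdeg_add_one hT (r := r) (v := m) (by omega)
      have h3 : {u | IsChild G r m u}.Nonempty := by
        rw [← Set.ncard_pos (Set.toFinite _)]
        change 0 < outdeg G r m
        omega
      obtain ⟨u, _, hu⟩ := h3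
      have := hm u (by simp)
      omega
  have hcard : Multiset.card (degSeq G) = Fintype.card V := by simp [degSeq]
  refine ⟨le_antisymm ?_ (le_radius G hT Δ h hdle hc), ?_⟩
  · exact (radius_le G r).trans (ecc_le G r h hdist)
  · have hge : ∀ H : SimpleGraph (Fin (Multiset.card (degSeq G))), H.IsTree →
        degSeq H = degSeq G → h ≤ treeRadius H := by
      intro H hH hs
      refine le_radius H hH Δ h (fun v => ?_) (by simpa [hcard] using hc)
      have : gdeg H v ∈ degSeq H := Multiset.mem_map_of_mem _ (Finset.mem_univ_val v)
      rw [hs] at this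
      obtain ⟨w, -, hw⟩ := Multiset.mem_map.1 this
      rw [← hw]
      exact hdle w
    let e : V ≃ Fin (Multiset.card (degSeq G)) := Fintype.equivFinOfCardEq hcard.symm
    let H := G.map e.toEmbedding
    let f : G ≃g H := Iso.map e G
    have hHT : H.IsTree := f.isTree_iff.1 hT
    have hHs : degSeq H = degSeq G := iso_degSeq f
    have hHr : treeRadius H ≤ h := by
      refine (radius_le H (f r)).trans (ecc_le H _ h fun u => ?_)
      obtain ⟨v, rfl⟩ := f.surjective u
      exact (iso_dist_le hT.connected f r v).trans (hdist v)
    refine le_antisymm ?_ ?_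
    · refine le_trans (Nat.sInf_le ?_) hHr
      exact ⟨H, hHT, hHs, rfl⟩
    · refine le_csInf ⟨_, H, hHT, hHs, rfl⟩ ?_
      rintro _ ⟨K, hK, hs, rfl⟩
      exact hge K hK hs
end

section
/- If T is a tree with no vertex of degree 2, then lp(T) ≥ diam(T)^{2/3} / 3, where diam(T) is the diameter of T. -/
open SimpleGraph

theorem lf_unique {V : Type*} {G : SimpleGraph V} (hT : G.IsTree) {x v c c' : V}
    (hc : G.Adj v c) (hc' : G.Adj v c')
    (h : G.dist x v = G.dist x c + 1) (h' : G.dist x v = G.dist x c' + 1) : c = c' := by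
  obtain ⟨p, hp⟩ := hT.connected.exists_walk_length_eq_dist c x
  obtain ⟨q, hq⟩ := hT.connected.exists_walk_length_eq_dist c' x
  have h1 : (Walk.cons hc p).IsPath := by
    apply Walk.isPath_of_length_eq_dist
    rw [Walk.length_cons, hp, dist_comm, ← h, dist_comm]
  have h2 : (Walk.cons hc' q).IsPath := by
    apply Walk.isPath_of_length_eq_dist
    rw [Walk.length_cons, hq, dist_comm, ← h', dist_comm]
  have h3 := hT.isAcyclic.path_unique ⟨_, h1⟩ ⟨_, h2⟩
  have h4 : Walk.cons hc p = Walk.cons hc' q := congrArg Subtype.val h3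
  have h5 := congrArg Walk.snd h4
  simpa using h5

theorem lf_closer {V : Type*} {G : SimpleGraph V} (hT : G.IsTree) {x v : V} (hne : x ≠ v) :
    ∃ c, G.Adj v c ∧ G.dist x v = G.dist x c + 1 := by
  obtain ⟨p, hp⟩ := hT.connected.exists_walk_length_eq_dist v x
  cases p with
  | nil => exact absurd rfl hne
  | @cons _ c _ hadj q =>
    refine ⟨c, hadj, ?_⟩
    rw [Walk.length_cons] at hp
    have h1 := G.dist_le q
    rcases hT.dist_eq_dist_add_one_of_adj x hadj with h | h
    · exact h
    · rw [G.dist_comm (u := v)] at hp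
      rw [G.dist_comm (u := c)] at h1
      omega

theorem lf_sep {V : Type*} {G : SimpleGraph V} (hT : G.IsTree) {x v c : V}
    (hc : G.Adj v c) (hx : G.dist x v = G.dist x c + 1) :
    ∀ (n : ℕ) (y : V), G.dist v y = n → G.dist y c = G.dist y v + 1 →
      G.dist x y = G.dist x v + n := by
  have side : ∀ y y' : V, G.Adj y y' → G.dist v y = G.dist v y' + 1 →
      G.dist y c = G.dist y v + 1 → G.dist y' c = G.dist y' v + 1 := by
    intro y y' ha hd hy
    rcases hT.dist_eq_dist_add_one_of_adj y' hc with h | h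
    · have h1 := hT.connected.dist_triangle (u := y) (v := y') (w := c)
      have h2 := dist_eq_one_iff_adj.mpr ha
      rw [G.dist_comm (u := v), G.dist_comm (u := v)] at hd
      omega
    · exact h
  intro n
  induction n using Nat.strong_induction_on with
  | _ n ih =>
    intro y hn hy
    by_cases hvy : v = y
    · subst hvy
      simp at hn
      omega
    obtain ⟨y', ha, hd⟩ := lf_closer hT hvy
    have hs := side y y' ha hd hy
    have i1 := ih (n - 1) (by omega) y' (by omega) hs
    rcases hT.dist_eq_dist_add_one_of_adj x ha with h | h
    · omega
    · exfalso
      by_cases hvy' : v = y'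
      · subst hvy'
        have : y = c := lf_unique hT ha.symm hc h hx
        subst this
        simp at hy
      · obtain ⟨y'', ha', hd'⟩ := lf_closer hT hvy'
        have hs' := side y' y'' ha' hd' hs
        have i2 := ih (n - 2) (by omega) y'' (by omega) hs'
        have : y = y'' := lf_unique hT ha.symm ha' h (by omega)
        subst this
        omega

theorem lf_sep' {V : Type*} {G : SimpleGraph V} (hT : G.IsTree) {x y v c c' : V}
    (hc : G.Adj v c) (hc' : G.Adj v c') (hne : c ≠ c')
    (hx : G.dist x v = G.dist x c + 1) (hy : G.dist y v = G.dist y c' + 1) :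
    G.dist x y = G.dist x v + G.dist v y := by
  apply lf_sep hT hc hx _ _ rfl
  rcases hT.dist_eq_dist_add_one_of_adj y hc with h | h
  · exact absurd (lf_unique hT hc hc' h hy) hne
  · exact h

/-- Lengths of leaf to leaf paths on the `w`-side of the edge `p w`. -/
def lfA {V : Type*} (G : SimpleGraph V) (p w : V) : Set ℕ :=
  {n | ∃ u v : V, IsLeafV G u ∧ IsLeafV G v ∧ G.dist u p = G.dist u w + 1 ∧
    G.dist v p = G.dist v w + 1 ∧ G.dist u v = n}

theorem lf_finite {V : Type*} [Fintype V] (G : SimpleGraph V) : (lpSet G).Finite := by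
  apply (Set.finite_range (fun q : V × V => G.dist q.1 q.2)).subset
  rintro n ⟨u, v, -, -, h⟩
  exact ⟨(u, v), h⟩

theorem lfA_sub {V : Type*} (G : SimpleGraph V) (p w : V) : lfA G p w ⊆ lpSet G := by
  rintro n ⟨u, v, h1, h2, -, -, h⟩
  exact ⟨u, v, h1, h2, h⟩

theorem lf_descend {V : Type*} [Fintype V] {G : SimpleGraph V} (hT : G.IsTree)
    (h2 : ∀ v, gdeg G v ≠ 2) :
    ∀ (N : ℕ) (p w : V), G.Adj p w → {x | G.dist x p = G.dist x w + 1}.ncard ≤ N →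
      ∃ z, IsLeafV G z ∧ G.dist z p = G.dist z w + 1 ∧ G.dist z w + 1 ≤ (lfA G p w).ncard := by
  intro N
  induction N with
  | zero =>
    intro p w hpw h
    have : {x | G.dist x p = G.dist x w + 1} = ∅ :=
      (Set.ncard_eq_zero (Set.toFinite _)).mp (by omega)
    have h3 : w ∈ {x | G.dist x p = G.dist x w + 1} := by
      simp [dist_eq_one_iff_adj.mpr hpw.symm]
    rw [this] at h3
    exact absurd h3 (by simp)
  | succ N ih =>
    intro p w hpw hN
    have hww : G.dist w p = G.dist w w + 1 := by
      simp [dist_eq_one_iff_adj.mpr hpw.symm]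
    have hfin : (lfA G p w).Finite := (lf_finite G).subset (lfA_sub G p w)
    by_cases hleaf : IsLeafV G w
    · refine ⟨w, hleaf, hww, ?_⟩
      have : 0 < (lfA G p w).ncard :=
        (Set.ncard_pos hfin).mpr ⟨0, w, w, hleaf, hleaf, hww, hww, by simp⟩
      simp only [dist_self]
      omega
    have hdeg : 3 ≤ {u | G.Adj w u}.ncard := by
      have := h2 w
      unfold IsLeafV at hleaf
      unfold gdeg at *
      omega
    have hd2 : 1 < ({u | G.Adj w u} \ {p}).ncard := by
      have := Set.ncard_sdiff_singleton_add_one (s := {u | G.Adj w u}) (a := p) hpw.symm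
        (Set.toFinite _)
      omega
    obtain ⟨c1, c2, hc1, hc2, hne⟩ := (Set.one_lt_ncard_iff (Set.toFinite _)).mp hd2
    have sub : ∀ c, c ∈ ({u | G.Adj w u} \ {p} : Set V) → ∀ x, G.dist x w = G.dist x c + 1 →
        G.dist x p = G.dist x w + 1 := by
      intro c hc x hx
      rcases hT.dist_eq_dist_add_one_of_adj x hpw with h | h
      · exact h
      · exact absurd (lf_unique hT hc.1 hpw.symm hx h) hc.2
    have hrec : ∀ c, c ∈ ({u | G.Adj w u} \ {p} : Set V) →
        ∃ z, IsLeafV G z ∧ G.dist z w = G.dist z c + 1 ∧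
          G.dist z c + 1 ≤ (lfA G w c).ncard := by
      intro c hc
      apply ih w c hc.1
      have : {x | G.dist x w = G.dist x c + 1}.ncard < {x | G.dist x p = G.dist x w + 1}.ncard := by
        apply Set.ncard_lt_ncard _ (Set.toFinite _)
        refine ⟨fun x hx => sub c hc x hx, fun h => ?_⟩
        have := h hww
        simp at this
      omega
    have hmax : ∀ c, c ∈ ({u | G.Adj w u} \ {p} : Set V) →
        ∃ z, (IsLeafV G z ∧ G.dist z w = G.dist z c + 1) ∧
          ∀ y, (IsLeafV G y ∧ G.dist y w = G.dist y c + 1) → G.dist y w ≤ G.dist z w := by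
      intro c hc
      obtain ⟨z, hz1, hz2, -⟩ := hrec c hc
      obtain ⟨m, hm, hm'⟩ := Set.exists_max_image
        {z | IsLeafV G z ∧ G.dist z w = G.dist z c + 1} (fun z => G.dist z w) (Set.toFinite _)
        ⟨z, hz1, hz2⟩
      exact ⟨m, hm, hm'⟩
    have key : ∀ c1 c2, c1 ∈ ({u | G.Adj w u} \ {p} : Set V) →
        c2 ∈ ({u | G.Adj w u} \ {p} : Set V) → c1 ≠ c2 → ∀ z1 z2,
        IsLeafV G z1 → G.dist z1 w = G.dist z1 c1 + 1 →
        IsLeafV G z2 → G.dist z2 w = G.dist z2 c2 + 1 →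
        (∀ y, (IsLeafV G y ∧ G.dist y w = G.dist y c2 + 1) → G.dist y w ≤ G.dist z2 w) →
        G.dist z2 w ≤ G.dist z1 w →
        ∃ z, IsLeafV G z ∧ G.dist z p = G.dist z w + 1 ∧
          G.dist z w + 1 ≤ (lfA G p w).ncard := by
      intro c1 c2 hc1 hc2 hne z1 z2 hl1 hz1 hl2 hz2 hm hle
      obtain ⟨z, hz, hzw, hzc⟩ := hrec c2 hc2
      refine ⟨z, hz, sub c2 hc2 z hzw, ?_⟩
      have hd := lf_sep' hT hc1.1 hc2.1 hne hz1 hz2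
      rw [G.dist_comm (u := w)] at hd
      have hnot : G.dist z1 z2 ∉ lfA G w c2 := by
        rintro ⟨u, v, hu, hv, hu', hv', huv⟩
        have t := hT.connected.dist_triangle (u := u) (v := c2) (w := v)
        rw [G.dist_comm (u := c2)] at t
        have m1 := hm u ⟨hu, hu'⟩
        have m2 := hm v ⟨hv, hv'⟩
        omega
      have hsub : insert (G.dist z1 z2) (lfA G w c2) ⊆ lfA G p w := by
        apply Set.insert_subset
        · exact ⟨z1, z2, hl1, hl2, sub c1 hc1 z1 hz1, sub c2 hc2 z2 hz2, rfl⟩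
        · rintro n ⟨u, v, hu, hv, hu', hv', huv⟩
          exact ⟨u, v, hu, hv, sub c2 hc2 u hu', sub c2 hc2 v hv', huv⟩
      have h3 := Set.ncard_le_ncard hsub hfin
      rw [Set.ncard_insert_of_notMem hnot ((lf_finite G).subset (lfA_sub G w c2))] at h3
      omega
    obtain ⟨z1, hz1, hm1⟩ := hmax c1 hc1
    obtain ⟨z2, hz2, hm2⟩ := hmax c2 hc2
    rcases le_total (G.dist z2 w) (G.dist z1 w) with h | h
    · exact key c1 c2 hc1 hc2 hne z1 z2 hz1.1 hz1.2 hz2.1 hz2.2 hm2 h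
    · exact key c2 c1 hc2 hc1 (Ne.symm hne) z2 z1 hz2.1 hz2.2 hz1.1 hz1.2 hm1 h

/-- The counting part. -/
theorem lf_count (A : Finset ℕ) (k D : ℕ) (hk : A.card = k) (hkpos : 0 < k) (l : ℕ → ℕ)
    (h1 : ∀ i, 1 ≤ i → i < D → 1 ≤ l i ∧ l i ≤ k ∧ i + l i ∈ A ∧ D - i + l i ∈ A) :
    ((D : ℝ) - 1) ≤ 2 * k * √k := by
  classical
  let I := Finset.Ico 1 D
  let W : ℕ → Finset ℕ := fun w => I.filter (fun i => i / k = w)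
  let R := Finset.range (D + 1)
  let X : ℕ → Finset ℕ := fun w => A.filter (fun a => w * k ≤ a ∧ a < (w + 2) * k)
  let Y : ℕ → Finset ℕ := fun w => A.filter (fun a => a ≤ D + k ∧
    w * k ≤ D + k - a ∧ D + k - a < (w + 2) * k)
  have hWk : ∀ w, (W w).card ≤ k := by
    intro w
    calc (W w).card ≤ (Finset.Ico (w * k) (w * k + k)).card := by
          apply Finset.card_le_card
          intro i hi
          simp only [W, Finset.mem_filter] at hi
          rw [Nat.div_eq_iff hkpos] at hi
          simp only [Finset.mem_Ico]
          omega
      _ = k := by simp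
  have hWXY : ∀ w, (W w).card ≤ (X w).card * (Y w).card := by
    intro w
    rw [← Finset.card_product]
    apply Finset.card_le_card_of_injOn (fun i => (i + l i, D - i + l i))
    · intro i hi
      simp only [W, I, Finset.coe_filter, Finset.mem_Ico, Set.mem_ofPred_eq] at hi
      obtain ⟨⟨a, b⟩, c⟩ := hi
      obtain ⟨p, q, r, s⟩ := h1 i a b
      rw [Nat.div_eq_iff hkpos] at c
      simp only [X, Y, Finset.coe_product, Finset.coe_filter, Set.mem_prod, Set.mem_ofPred_eq, add_mul]
      refine ⟨⟨r, ?_, ?_⟩, s, ?_, ?_, ?_⟩ <;> omega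
    · intro i hi j hj hij
      simp only [W, I, Finset.coe_filter, Finset.mem_Ico, Set.mem_ofPred_eq] at hi hj
      simp only [Prod.mk.injEq] at hij
      omega
  have hsum : ∀ (f : ℕ → ℕ) (P : ℕ → Prop) [DecidablePred P],
      ∑ w ∈ R, (A.filter (fun a => P a ∧ w * k ≤ f a ∧ f a < (w + 2) * k)).card ≤ 2 * k := by
    intro f P _
    have := Finset.sum_card_bipartiteAbove_eq_sum_card_bipartiteBelow
      (s := R) (t := A) (fun w a => P a ∧ w * k ≤ f a ∧ f a < (w + 2) * k)
    unfold Finset.bipartiteAbove Finset.bipartiteBelow at this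
    rw [this]
    calc _ ≤ ∑ a ∈ A, 2 := by
          apply Finset.sum_le_sum
          intro a _
          calc _ ≤ ({f a / k, f a / k - 1} : Finset ℕ).card := by
                apply Finset.card_le_card
                intro w hw
                simp only [Finset.mem_filter] at hw
                obtain ⟨-, -, h3, h4⟩ := hw
                have h5 := (Nat.le_div_iff_mul_le hkpos).mpr h3
                have h6 := (Nat.div_lt_iff_lt_mul hkpos).mpr h4
                simp only [Finset.mem_insert, Finset.mem_singleton]
                omega
            _ ≤ 2 := Finset.card_le_two
      _ = 2 * k := by rw [Finset.sum_const, hk, smul_eq_mul, mul_comm]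
  have hX : ∑ w ∈ R, (X w).card ≤ 2 * k := by
    have := hsum (fun a => a) (fun _ => True)
    simpa [X] using this
  have hY : ∑ w ∈ R, (Y w).card ≤ 2 * k := hsum (fun a => D + k - a) (fun a => a ≤ D + k)
  have hI : I.card = ∑ w ∈ R, (W w).card := by
    apply Finset.card_eq_sum_card_fiberwise
    intro i hi
    simp only [I, Finset.coe_Ico, Set.mem_Ico] at hi
    simp only [R, Finset.coe_range, Set.mem_Iio]
    have := Nat.div_le_self i k
    omega
  have hW : ∀ w, ((W w).card : ℝ) ≤ √k * (((X w).card + (Y w).card) / 2) := by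
    intro w
    have a1 : ((W w).card : ℝ) ≤ k := by exact_mod_cast hWk w
    have a2 : ((W w).card : ℝ) ≤ (X w).card * (Y w).card := by exact_mod_cast hWXY w
    refine le_of_pow_le_pow_left₀ two_ne_zero (by positivity) ?_
    rw [mul_pow, Real.sq_sqrt (by positivity)]
    have h0 : (0 : ℝ) ≤ (W w).card := by positivity
    have h00 : (0 : ℝ) ≤ k := by positivity
    have e1 : ((W w).card : ℝ) ^ 2 ≤ k * ((X w).card * (Y w).card) := by
      rw [sq]; exact mul_le_mul a1 a2 h0 h00
    have e2 : ((X w).card * (Y w).card : ℝ) ≤ (((X w).card + (Y w).card) / 2) ^ 2 := by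
      nlinarith [sq_nonneg (((X w).card : ℝ) - (Y w).card)]
    exact e1.trans (mul_le_mul_of_nonneg_left e2 h00)
  have hXr : ∑ w ∈ R, ((X w).card : ℝ) ≤ 2 * k := by exact_mod_cast hX
  have hYr : ∑ w ∈ R, ((Y w).card : ℝ) ≤ 2 * k := by exact_mod_cast hY
  have hIr : (D : ℝ) - 1 ≤ ∑ w ∈ R, ((W w).card : ℝ) := by
    have : (D : ℝ) ≤ I.card + 1 := by
      have : D ≤ I.card + 1 := by simp only [I, Nat.card_Ico]; omega
      exact_mod_cast this
    rw [hI] at this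
    push_cast at this
    linarith
  calc (D : ℝ) - 1 ≤ ∑ w ∈ R, ((W w).card : ℝ) := hIr
    _ ≤ ∑ w ∈ R, √k * (((X w).card + (Y w).card) / 2) := Finset.sum_le_sum (fun w _ => hW w)
    _ = √k * ((∑ w ∈ R, ((X w).card : ℝ) + ∑ w ∈ R, ((Y w).card : ℝ)) / 2) := by
        rw [← Finset.mul_sum, ← Finset.sum_div, Finset.sum_add_distrib]
    _ ≤ √k * (2 * k) := by
        apply mul_le_mul_of_nonneg_left _ (Real.sqrt_nonneg _)
        linarith
    _ = 2 * k * √k := by ring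

theorem lf_end {V : Type*} [Fintype V] {G : SimpleGraph V} (hT : G.IsTree) {a b : V}
    (hne : a ≠ b) (hmax : ∀ u, G.dist a u ≤ G.dist a b) : IsLeafV G b := by
  unfold IsLeafV gdeg
  rw [Set.ncard_le_one (Set.toFinite _)]
  have : ∀ c, G.Adj b c → G.dist a b = G.dist a c + 1 := by
    intro c hc
    have := hmax c
    rcases hT.dist_eq_dist_add_one_of_adj a hc with h | h <;> omega
  intro c hc c' hc'
  exact lf_unique hT hc hc' (this c hc) (this c' hc')

theorem lf_main {V : Type*} [Fintype V] (G : SimpleGraph V) (hT : G.IsTree)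
    (h2 : ∀ v, gdeg G v ≠ 2) (hpos : 0 < treeDiam G) :
    0 < (lpSet G).ncard ∧ ((treeDiam G : ℝ) - 1) ≤ 2 * (lpSet G).ncard * √((lpSet G).ncard) := by
  classical
  have hfinD : {d | ∃ u v : V, G.dist u v = d}.Finite := by
    apply (Set.finite_range (fun q : V × V => G.dist q.1 q.2)).subset
    rintro n ⟨u, v, h⟩
    exact ⟨(u, v), h⟩
  have hbdd := hfinD.bddAbove
  have hle : ∀ u v, G.dist u v ≤ treeDiam G := fun u v => le_csSup hbdd ⟨u, v, rfl⟩
  obtain ⟨x0⟩ := hT.connected.nonempty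
  obtain ⟨a, b, hab⟩ : treeDiam G ∈ {d | ∃ u v : V, G.dist u v = d} :=
    Nat.sSup_mem ⟨_, x0, x0, rfl⟩ hbdd
  generalize hD : treeDiam G = D at *
  have hne : a ≠ b := by
    rintro rfl
    simp at hab
    omega
  have hlb : IsLeafV G b := lf_end hT hne (fun u => by rw [hab]; exact hle a u)
  have hla : IsLeafV G a := lf_end hT hne.symm (fun u => by
    rw [G.dist_comm (u := b) (v := a), hab]; exact hle b u)
  have hfin := lf_finite G
  have hkpos : 0 < (lpSet G).ncard := (Set.ncard_pos hfin).mpr ⟨D, a, b, hla, hlb, hab⟩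
  refine ⟨hkpos, ?_⟩
  obtain ⟨p, hp⟩ := hT.connected.exists_walk_length_eq_dist a b
  have hex : ∀ i, ∃ l, 1 ≤ i → i < D →
      1 ≤ l ∧ l ≤ (lpSet G).ncard ∧ i + l ∈ lpSet G ∧ D - i + l ∈ lpSet G := by
    intro i
    by_cases hi : 1 ≤ i ∧ i < D
    swap
    · exact ⟨0, fun h h' => absurd ⟨h, h'⟩ hi⟩
    obtain ⟨hi1, hiD⟩ := hi
    obtain ⟨v, hv⟩ : ∃ v, p.getVert i = v := ⟨_, rfl⟩
    have d1 : G.dist a v ≤ i := by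
      have := G.dist_le (p.take i)
      rw [Walk.take_length, hv] at this
      omega
    have d2 : G.dist v b ≤ D - i := by
      have := G.dist_le (p.drop i)
      rw [Walk.drop_length, hv] at this
      omega
    have d3 := hT.connected.dist_triangle (u := a) (v := v) (w := b)
    have e1 : G.dist a v = i := by omega
    have e2 : G.dist b v = D - i := by rw [G.dist_comm]; omega
    have av : a ≠ v := by
      intro h; rw [← h] at e1; simp at e1; omega
    have bv : b ≠ v := by
      intro h; rw [← h] at e2; simp at e2; omega
    obtain ⟨ca, hca, hca'⟩ := lf_closer hT av
    obtain ⟨cb, hcb, hcb'⟩ := lf_closer hT bv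
    have hcc : ca ≠ cb := by
      rintro rfl
      have := hT.connected.dist_triangle (u := a) (v := ca) (w := b)
      rw [G.dist_comm (u := ca)] at this
      omega
    have hsub : ({ca, cb} : Set V) ⊆ {u | G.Adj v u} := by
      rintro x (rfl | rfl) <;> assumption
    have hss : ({ca, cb} : Set V) ⊂ {u | G.Adj v u} := by
      refine hsub.ssubset_of_ne (fun h => h2 v ?_)
      unfold gdeg
      rw [← h, Set.ncard_pair hcc]
    obtain ⟨c, hc, hcn⟩ := Set.exists_of_ssubset hss
    simp only [Set.mem_insert_iff, Set.mem_singleton_iff, not_or] at hcn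
    obtain ⟨z, hz, hzv, hzk⟩ := lf_descend hT h2 _ v c hc le_rfl
    have hk := hzk.trans (Set.ncard_le_ncard (lfA_sub G v c) hfin)
    have f1 := lf_sep' hT hca hc (Ne.symm hcn.1) hca' hzv
    have f2 := lf_sep' hT hcb hc (Ne.symm hcn.2) hcb' hzv
    rw [G.dist_comm (u := v) (v := z)] at f1 f2
    refine ⟨G.dist z v, fun _ _ => ⟨by omega, by omega, ?_, ?_⟩⟩
    · exact ⟨a, z, hla, hz, by omega⟩
    · exact ⟨b, z, hlb, hz, by omega⟩
  choose l hl using hex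
  refine lf_count hfin.toFinset _ D (Set.ncard_eq_toFinset_card _ hfin).symm hkpos l ?_
  intro i hi hiD
  simpa using hl i hi hiD

/-- If `T` is a tree with no vertex of degree `2`, then `lp(T) ≥ diam(T)^{2/3} / 3`. -/
theorem stmt_16 {V : Type*} [Fintype V] (G : SimpleGraph V) (hT : G.IsTree)
    (h2 : ∀ v, gdeg G v ≠ 2) :
    (treeDiam G : ℝ) ^ ((2 : ℝ) / 3) / 3 ≤ ((lpSet G).ncard : ℝ) := by
  rcases Nat.eq_zero_or_pos (treeDiam G) with h0 | hpos
  · rw [h0, Nat.cast_zero, Real.zero_rpow (by norm_num)]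
    simp
  obtain ⟨hk, hD⟩ := lf_main G hT h2 hpos
  generalize (lpSet G).ncard = k at *
  generalize treeDiam G = D at *
  have hk1 : (1 : ℝ) ≤ k := by exact_mod_cast hk
  have hs1 : (1 : ℝ) ≤ √k := Real.one_le_sqrt.mpr hk1
  have hD3 : (D : ℝ) ≤ 3 * k * √k := by nlinarith
  have hsq : (D : ℝ) ^ 2 ≤ (3 * k) ^ 3 := by
    have e : (D : ℝ) ^ 2 ≤ (3 * k * √k) ^ 2 := pow_le_pow_left₀ (by positivity) hD3 2
    rw [mul_pow, Real.sq_sqrt (by positivity)] at e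
    have : (0 : ℝ) ≤ (k : ℝ) ^ 3 := by positivity
    nlinarith
  have h3 : (D : ℝ) ^ ((2 : ℝ) / 3) ≤ 3 * k := by
    apply le_of_pow_le_pow_left₀ (n := 3) (by norm_num) (by positivity)
    rw [← Real.rpow_natCast, ← Real.rpow_mul (by positivity)]
    norm_num
    convert hsq using 1
  linarith
end
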